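/- arXiv:2404.11838 — 8 statements merged into one kernel-verified Lean document; each statement's English description precedes it below -/
import Mathlib

section
/- Let G be a finite connected simple graph with n vertices and m edges in which every vertex has degree 3. Let (c_i)_{i∈ι} be a family of circuits of G, indexed by a finite type ι, such that for every edge e of G the number of indices i for which e occurs among the edges of c_i equals 2. Then the cardinality of ι is at most m − n + 2 (that is, at most g + 1, where g = m − n + 1 is the genus of G). -/
open Matrix in
/-- A matrix whose kernel consists of constant vectors has corank at most one. -/
theorem Matrix.card_le_rank_add_one_of_ker_const {K m n : Type*} [Field K] [Fintype m] [Fintype n]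
    (A : Matrix m n K) (h : ∀ x : n → K, A *ᵥ x = 0 → ∀ i j, x i = x j) :
    Fintype.card n ≤ A.rank + 1 := by
  have hrn := A.mulVecLin.finrank_range_add_finrank_ker
  rw [Module.finrank_fintype_fun_eq_card] at hrn
  have hker : Module.finrank K (LinearMap.ker A.mulVecLin) ≤ 1 := by
    have hle : LinearMap.ker A.mulVecLin ≤ Submodule.span K {fun _ : n => (1 : K)} := by
      intro x hx
      have hx := h x (by simpa using hx)
      rw [Submodule.mem_span_singleton]
      rcases isEmpty_or_nonempty n with _ | ⟨⟨i⟩⟩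
      · exact ⟨0, Subsingleton.elim _ _⟩
      · exact ⟨x i, funext fun j => by simpa using hx i j⟩
    refine (Submodule.finrank_mono hle).trans ?_
    simpa using finrank_span_le_card (R := K) {fun _ : n => (1 : K)}
  rw [Matrix.rank]
  omega

namespace SimpleGraph

variable {V : Type*} {G : SimpleGraph V}

/-- A vertex function which agrees along edges of a connected graph is constant. -/
theorem Connected.eq_of_forall_adj {α : Type*} (hG : G.Connected) {f : V → α}
    (hf : ∀ v w, G.Adj v w → f v = f w) (v w : V) : f v = f w := by
  obtain ⟨p⟩ := hG.preconnected v w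
  induction p with
  | nil => rfl
  | cons h _ ih => exact (hf _ _ h).trans ih

open Classical in
/-- A closed trail uses an even number of the edges at each vertex. -/
theorem Walk.IsTrail.even_card_edges_filter_mem {u : V} {p : G.Walk u u} (hp : p.IsTrail) (v : V) :
    Even (p.edges.toFinset.filter (v ∈ ·)).card := by
  have h := (hp.even_countP_edges_iff v).2 (fun h => absurd rfl h)
  rw [List.countP_eq_length_filter] at h
  rw [← List.toFinset_card_of_nodup (hp.edges_nodup.filter _)] at h
  convert h using 2
  ext
  simp

open Classical in
/-- If `v` has exactly the neighbours `a`, `b`, `d`, then a closed trail through the edge `va`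
leaves `v` along `vb` or `vd`. -/
theorem Walk.IsTrail.mem_edges_or_of_neighbors {u : V} {p : G.Walk u u} (hp : p.IsTrail)
    {v a b d : V} (hN : ∀ w, G.Adj v w → w = a ∨ w = b ∨ w = d) (ha : s(v, a) ∈ p.edges) :
    s(v, b) ∈ p.edges ∨ s(v, d) ∈ p.edges := by
  by_contra! hcon
  have hone : p.edges.toFinset.filter (v ∈ ·) = {s(v, a)} := by
    ext e
    simp only [Finset.mem_filter, List.mem_toFinset, Finset.mem_singleton]
    constructor
    · rintro ⟨he, hv⟩
      obtain ⟨w, rfl⟩ := Sym2.mem_iff_exists.1 hv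
      rcases hN w (p.adj_of_mem_edges he) with rfl | rfl | rfl
      · rfl
      · exact absurd he hcon.1
      · exact absurd he hcon.2
    · rintro rfl
      exact ⟨ha, Sym2.mem_mk_left _ _⟩
  have h := hp.even_card_edges_filter_mem v
  simp [hone] at h

/-- In a double cover of a trivalent graph by closed trails, two edges with a common endpoint
lie on a common trail. -/
theorem exists_mem_edges_mem_edges_of_double_cover [Fintype V] [DecidableRel G.Adj]
    (hdeg : ∀ v : V, G.degree v = 3) {ι : Type*} [Finite ι]
    {u : ι → V} {c : ∀ i : ι, G.Walk (u i) (u i)} (hc : ∀ i, (c i).IsTrail)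
    (hcover : ∀ e ∈ G.edgeSet, {i : ι | e ∈ (c i).edges}.ncard = 2)
    {v a b : V} (ha : G.Adj v a) (hb : G.Adj v b) :
    ∃ i, s(v, a) ∈ (c i).edges ∧ s(v, b) ∈ (c i).edges := by
  classical
  rcases eq_or_ne a b with rfl | hab
  · obtain ⟨i, hi⟩ := Set.nonempty_of_ncard_ne_zero (by rw [hcover s(v, a) ha]; decide)
    exact ⟨i, hi, hi⟩
  obtain ⟨d, hd⟩ : ∃ d, (G.neighborFinset v \ {a, b}) = {d} := by
    rw [← Finset.card_eq_one, Finset.card_sdiff_of_subset (by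
      intro x; simp only [Finset.mem_insert, Finset.mem_singleton, mem_neighborFinset]
      rintro (rfl | rfl) <;> assumption), Finset.card_pair hab, card_neighborFinset_eq_degree,
      hdeg]
  simp only [Finset.ext_iff, Finset.mem_sdiff, mem_neighborFinset, Finset.mem_insert,
    Finset.mem_singleton] at hd
  have hvd : G.Adj v d := ((hd d).2 rfl).1
  by_contra! hcon
  have hdisj : Disjoint {i | s(v, a) ∈ (c i).edges} {i | s(v, b) ∈ (c i).edges} :=
    Set.disjoint_left.2 hcon
  have hsub : {i | s(v, a) ∈ (c i).edges} ∪ {i | s(v, b) ∈ (c i).edges} ⊆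
      {i | s(v, d) ∈ (c i).edges} := by
    rintro i (hi | hi)
    · exact ((hc i).mem_edges_or_of_neighbors (b := b) (d := d)
        (fun w hw => by have := hd w; tauto) hi).resolve_left (hcon i hi)
    · exact ((hc i).mem_edges_or_of_neighbors (b := a) (d := d)
        (fun w hw => by have := hd w; tauto) hi).resolve_left (fun h => hcon i h hi)
  have hcard := Set.ncard_le_ncard hsub
  rw [Set.ncard_union_eq hdisj, hcover s(v, a) ha, hcover s(v, b) hb, hcover s(v, d) hvd] at hcard
  omega

/-- A function on the members of a double cover of a connected trivalent graph by circuits is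
constant if it agrees on any two members sharing an edge. -/
theorem Connected.eq_of_double_cover [Fintype V] [DecidableRel G.Adj]
    (hconn : G.Connected) (hdeg : ∀ v : V, G.degree v = 3) {ι α : Type*} [Finite ι]
    {u : ι → V} {c : ∀ i : ι, G.Walk (u i) (u i)} (hc : ∀ i, (c i).IsCircuit)
    (hcover : ∀ e ∈ G.edgeSet, {i : ι | e ∈ (c i).edges}.ncard = 2) {x : ι → α}
    (hx : ∀ e i j, e ∈ (c i).edges → e ∈ (c j).edges → x i = x j) (i j : ι) : x i = x j := by
  have hvert : ∀ v i j a b, s(v, a) ∈ (c i).edges → s(v, b) ∈ (c j).edges → x i = x j := by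
    intro v i j a b ha hb
    obtain ⟨k, hka, hkb⟩ := exists_mem_edges_mem_edges_of_double_cover hdeg
      (fun i => (hc i).isTrail) hcover ((c i).adj_of_mem_edges ha) ((c j).adj_of_mem_edges hb)
    exact (hx _ _ _ ha hka).trans (hx _ _ _ hkb hb)
  have hstart : ∀ i, ∃ a, s(u i, a) ∈ (c i).edges := by
    intro i
    have := (hc i).ne_nil
    cases h : c i with
    | nil => exact absurd h this
    | cons => exact ⟨_, by rw [Walk.edges_cons]; exact List.mem_cons_self⟩
  have hon : ∀ v, ∃ i a, s(v, a) ∈ (c i).edges := by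
    intro v
    obtain ⟨a, ha⟩ := (G.degree_pos_iff_exists_adj v).1 (by rw [hdeg]; decide)
    obtain ⟨i, hi, -⟩ := exists_mem_edges_mem_edges_of_double_cover hdeg
      (fun i => (hc i).isTrail) hcover ha ha
    exact ⟨i, a, hi⟩
  choose k a hk using hon
  have hconst := hconn.eq_of_forall_adj (f := fun v => x (k v)) (by
    intro v w hvw
    obtain ⟨l, hl, -⟩ := exists_mem_edges_mem_edges_of_double_cover hdeg
      (fun i => (hc i).isTrail) hcover hvw hvw
    exact (hvert v _ _ _ _ (hk v) hl).trans
      (hvert w _ _ _ _ (by rwa [Sym2.eq_swap] at hl) (hk w)))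
  obtain ⟨p, hp⟩ := hstart i
  obtain ⟨q, hq⟩ := hstart j
  exact (hvert _ _ _ _ _ hp (hk _)).trans ((hconst _ _).trans (hvert _ _ _ _ _ (hk _) hq))

end SimpleGraph

/-- For a finite connected trivalent simple graph `G` with `n` vertices
and `m` edges, any family of circuits indexed by a finite type `ι` in which every edge
of `G` occurs in exactly two members satisfies `|ι| ≤ m - n + 2`, stated here as
`|ι| + n ≤ m + 2`. -/
theorem circuit_double_cover_card_le
    {V : Type*} [Fintype V] (G : SimpleGraph V) [DecidableRel G.Adj]
    (hconn : G.Connected) (hdeg : ∀ v : V, G.degree v = 3)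
    {ι : Type*} [Fintype ι]
    (u : ι → V) (c : ∀ i : ι, G.Walk (u i) (u i))
    (hcirc : ∀ i : ι, (c i).IsCircuit)
    (hcover : ∀ e ∈ G.edgeSet, {i : ι | e ∈ (c i).edges}.ncard = 2) :
    Fintype.card ι + Fintype.card V ≤ G.edgeSet.ncard + 2 := by
  classical
  let M : Matrix V G.edgeSet (ZMod 2) := .of fun v e => if v ∈ e.1 then 1 else 0
  let C : Matrix G.edgeSet ι (ZMod 2) := .of fun e i => if e.1 ∈ (c i).edges then 1 else 0
  have hMC : M * C = 0 := by
    ext v i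
    have hcard : (Finset.univ.filter fun e : G.edgeSet => v ∈ e.1 ∧ e.1 ∈ (c i).edges).card =
        ((c i).edges.toFinset.filter (v ∈ ·)).card := by
      refine Finset.card_bij (fun e _ => e.1) ?_ (fun _ _ _ _ h => Subtype.ext h) ?_
      · simp +contextual
      · intro e he
        simp only [Finset.mem_filter, List.mem_toFinset] at he
        exact ⟨⟨e, (c i).edges_subset_edgeSet he.1⟩, by simp [he], rfl⟩
    simp only [Matrix.mul_apply, M, C, Matrix.of_apply, Matrix.zero_apply, ite_zero_mul_ite_zero,
      mul_one, Finset.sum_boole, ZMod.natCast_eq_zero_iff_even, hcard]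
    exact (hcirc i).isTrail.even_card_edges_filter_mem v
  have hM : Fintype.card V ≤ M.rank + 1 := by
    rw [← Matrix.rank_transpose]
    refine Matrix.card_le_rank_add_one_of_ker_const _ fun y hy => hconn.eq_of_forall_adj ?_
    intro v w hvw
    have h := congrFun hy ⟨s(v, w), hvw⟩
    simp only [Matrix.mulVec, dotProduct, M, Matrix.transpose_apply, Matrix.of_apply, ite_mul,
      one_mul, zero_mul, Pi.zero_apply, ← Finset.sum_filter] at h
    have hfil : Finset.univ.filter (· ∈ s(v, w)) = {v, w} := by ext; simp
    rw [hfil, Finset.sum_pair hvw.ne] at h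
    exact CharTwo.add_eq_zero.1 h
  have hC : Fintype.card ι ≤ C.rank + 1 := by
    refine Matrix.card_le_rank_add_one_of_ker_const _ fun x hx =>
      hconn.eq_of_double_cover hdeg hcirc hcover ?_
    intro e i j hi hj
    have he := (c i).edges_subset_edgeSet hi
    have h := congrFun hx ⟨e, he⟩
    simp only [Matrix.mulVec, dotProduct, C, Matrix.of_apply, ite_mul,
      one_mul, zero_mul, Pi.zero_apply, ← Finset.sum_filter] at h
    obtain ⟨p, q, hpq, hset⟩ := Set.ncard_eq_two.1 (hcover e he)
    have hmem : ∀ k, e ∈ (c k).edges ↔ k = p ∨ k = q := fun k => by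
      simpa using Set.ext_iff.1 hset k
    have hfil : Finset.univ.filter (fun k => e ∈ (c k).edges) = {p, q} := by ext; simp [hmem]
    rw [hfil, Finset.sum_pair hpq] at h
    have hxpq := CharTwo.add_eq_zero.1 h
    rcases (hmem i).1 hi with rfl | rfl <;> rcases (hmem j).1 hj with rfl | rfl <;>
      simp [hxpq]
  have hrank := Matrix.rank_add_rank_le_card_of_mul_eq_zero hMC
  rw [Set.ncard_eq_toFinset_card', Set.toFinset_card]
  omega
end

section
/- Let G be a finite connected simple graph with n vertices and m edges in which every vertex has degree 3. Let (c_i)_{i∈ι} be a family of circuits of G, indexed by a finite type ι with exactly m − n + 2 elements, such that for every edge e of G the number of indices i for which e occurs among the edges of c_i equals 2. Then every c_i is a simple cycle, i.e., a circuit with no repeated vertices other than its endpoint. -/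
namespace SimpleGraph

variable {V : Type*} {G : SimpleGraph V}

/-- Darts have no loops, so each dart whose edge contains `v` either starts or ends at `v`,
but not both. -/
theorem countP_mem_map_edge_darts [DecidableEq V] (v : V) (l : List G.Dart) :
    (l.map Dart.edge).countP (fun e => v ∈ e) =
      (l.map (·.fst)).count v + (l.map (·.snd)).count v := by
  induction l with
  | nil => simp
  | cons d l ih =>
    have hne : d.fst ≠ d.snd := d.adj.ne
    have hmem : v ∈ d.edge ↔ v = d.fst ∨ v = d.snd := by
      rw [← Sym2.mem_iff]
      rfl
    simp only [List.map_cons, List.countP_cons, List.count_cons, ih, hmem, beq_iff_eq,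
      decide_eq_true_eq]
    grind

/-- A closed walk enters each vertex as often as it leaves it. -/
theorem Walk.count_map_fst_darts [DecidableEq V] {u : V} (c : G.Walk u u) (v : V) :
    (c.darts.map (·.fst)).count v = c.support.tail.count v := by
  have h := congrArg (List.count v) (c.map_fst_darts_append)
  rw [← c.cons_tail_support, List.count_append, List.count_cons, List.count_nil,
    List.count_cons] at h
  omega

/-- A closed trail passing `k` times through `v` uses `2 * k` edges at `v`. -/
theorem Walk.IsTrail.two_mul_count_support_tail_le_degree [DecidableEq V] {u : V}
    {c : G.Walk u u} (hc : c.IsTrail) (v : V) [Fintype (G.neighborSet v)] :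
    2 * c.support.tail.count v ≤ G.degree v := by
  have hcount := countP_mem_map_edge_darts v c.darts
  rw [c.count_map_fst_darts, c.map_snd_darts] at hcount
  have hnodup : (c.edges.filter (fun e => v ∈ e)).Nodup := hc.edges_nodup.filter _
  rw [← G.card_incidenceFinset_eq_degree v, two_mul, ← hcount, List.countP_eq_length_filter]
  change (c.edges.filter (fun e => v ∈ e)).length ≤ _
  rw [← List.toFinset_card_of_nodup hnodup]
  refine Finset.card_le_card fun e he => ?_
  rw [List.mem_toFinset, List.mem_filter, decide_eq_true_eq] at he
  rw [mem_incidenceFinset]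
  exact ⟨c.edges_subset_edgeSet he.1, he.2⟩

/-- In a graph of maximum degree at most three every circuit is a cycle. -/
theorem Walk.IsCircuit.isCycle_of_degree_le_three [G.LocallyFinite]
    (hdeg : ∀ v, G.degree v ≤ 3) {u : V} {c : G.Walk u u} (hc : c.IsCircuit) : c.IsCycle := by
  classical
  refine ⟨hc, List.nodup_iff_count_le_one.mpr fun v => ?_⟩
  have h := hc.isTrail.two_mul_count_support_tail_le_degree v
  have := hdeg v
  omega

end SimpleGraph

/-- If a finite connected trivalent simple graph `G` with `n` vertices and
`m` edges admits a family of circuits, indexed by a finite type with exactly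
`m - n + 2` elements (stated as `|ι| + n = m + 2`), in which every edge of `G` occurs
in exactly two members, then every member of the family is a simple cycle. -/
theorem circuit_double_cover_max_isCycle
    {V : Type*} [Fintype V] (G : SimpleGraph V) [DecidableRel G.Adj]
    (hconn : G.Connected) (hdeg : ∀ v : V, G.degree v = 3)
    {ι : Type*} [Fintype ι]
    (u : ι → V) (c : ∀ i : ι, G.Walk (u i) (u i))
    (hcirc : ∀ i : ι, (c i).IsCircuit)
    (hcard : Fintype.card ι + Fintype.card V = G.edgeSet.ncard + 2)
    (hcover : ∀ e ∈ G.edgeSet, {i : ι | e ∈ (c i).edges}.ncard = 2) :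
    ∀ i : ι, (c i).IsCycle := by
  exact fun i => (hcirc i).isCycle_of_degree_le_three fun v => (hdeg v).le
end

section
/- Let G be a finite simple graph with at least 4 vertices in which every vertex has degree 3, and assume G is 3-connected, i.e., for every set S of at most two vertices the subgraph of G induced on the complement of S is connected. Let n be the number of vertices and m the number of edges of G, and set g = m − n + 1. Suppose (c_i)_{i∈ι} and (d_j)_{j∈κ} are two families of circuits of G, indexed by finite types ι and κ each of cardinality g + 1, such that in each family every edge of G occurs among the edges of exactly two members. Then the two families determine the same collection of edge sets: the set { edge set of c_i : i ∈ ι } equals the set { edge set of d_j : j ∈ κ }. -/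
namespace SimpleGraph

theorem _root_.ZMod.two_eq_zero_or_one (a : ZMod 2) : a = 0 ∨ a = 1 := by
  revert a; decide

theorem _root_.Matrix.card_le_rank_add_one {K m n : Type*} [Field K] [Fintype m] [Fintype n]
    (A : Matrix m n K)
    (h : ∀ y, A.mulVec y = 0 → ∃ t, y = fun _ => t) : Fintype.card n ≤ A.rank + 1 := by
  classical
  have h₁ := LinearMap.finrank_range_add_finrank_ker A.mulVecLin
  have h₂ : LinearMap.ker A.mulVecLin ≤ Submodule.span K {fun _ : n => (1 : K)} := by
    intro y hy
    obtain ⟨t, rfl⟩ := h y (by simpa using hy)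
    refine Submodule.mem_span_singleton.2 ⟨t, ?_⟩
    ext; simp
  have h₃ := (Submodule.finrank_mono h₂).trans (finrank_span_le_card _)
  rw [Set.toFinset_card, Fintype.card_unique] at h₃
  rw [Module.finrank_fintype_fun_eq_card] at h₁
  rw [Matrix.rank]
  omega

/-- The mod 2 indicator of the edges of a walk. -/
def Walk.edgeVector {V : Type*} [DecidableEq V] {G : SimpleGraph V} {u v : V} (p : G.Walk u v)
    (e : Sym2 V) : ZMod 2 :=
  if e ∈ p.edges then 1 else 0

theorem Walk.edgeVector_eq_one_iff {V : Type*} [DecidableEq V] {G : SimpleGraph V} {u v : V}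
    {p : G.Walk u v} {e : Sym2 V} :
    p.edgeVector e = 1 ↔ e ∈ p.edges := by
  simp [edgeVector]

theorem Walk.apply_eq_of_mem_edges {V : Type*} {G : SimpleGraph V} {F x : Sym2 V → ZMod 2}
    (hloc : ∀ w, ∀ a ∈ G.incidenceSet w, ∀ b ∈ G.incidenceSet w, F a = 1 → F b = 1 → x a = x b)
    {u v : V} (p : G.Walk u v) (hp : ∀ e ∈ p.edges, F e = 1) {e₀ : Sym2 V}
    (he₀ : e₀ ∈ G.incidenceSet u) (hF : F e₀ = 1) {e : Sym2 V} (he : e ∈ p.edges) :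
    x e = x e₀ := by
  induction p generalizing e₀ with
  | nil => simp at he
  | @cons a b c h q ih =>
    have hab : F s(a, b) = 1 := hp _ (by simp)
    have h₀ : x s(a, b) = x e₀ := hloc a _ ⟨h, by simp⟩ _ he₀ hab hF
    rw [edges_cons, List.mem_cons] at he
    rcases he with rfl | he
    · exact h₀
    · rw [← h₀]
      exact ih (fun f hf => hp f (by simp [hf])) ⟨h, by simp⟩ hab he

variable {V : Type*} [Fintype V] [DecidableEq V] (G : SimpleGraph V) [DecidableRel G.Adj]

/-- The boundary of a mod 2 edge chain of `G`. -/
def boundary (x : Sym2 V → ZMod 2) (w : V) : ZMod 2 := ∑ e ∈ G.incidenceFinset w, x e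

/-- A mod 2 chain supported on the edges of `G` with zero boundary. -/
structure IsCycleVector (x : Sym2 V → ZMod 2) : Prop where
  supp : ∀ e, e ∉ G.edgeSet → x e = 0
  boundary_eq_zero : ∀ w, G.boundary x w = 0

/-- A family of minimal nonzero cycle vectors that covers every edge exactly twice. -/
structure IsDoubleCover {ι : Type*} (C : ι → Sym2 V → ZMod 2) : Prop where
  cyc : ∀ i, G.IsCycleVector (C i)
  ne_zero : ∀ i, C i ≠ 0
  cov : ∀ e ∈ G.edgeSet, ∃ i j, i ≠ j ∧ ∀ k, C k e = 1 ↔ k = i ∨ k = j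
  minimal : ∀ i x, G.IsCycleVector x → (∀ e, C i e = 0 → x e = 0) → x ≠ 0 → x = C i

variable {G}

theorem boundary_add (x y : Sym2 V → ZMod 2) (w : V) :
    G.boundary (x + y) w = G.boundary x w + G.boundary y w := by
  simp [boundary, Finset.sum_add_distrib]

theorem boundary_single {a b : V} (h : G.Adj a b) (w : V) :
    G.boundary (Pi.single s(a, b) 1) w =
      (if w = a then 1 else 0) + (if w = b then 1 else 0) := by
  have := h.ne
  simp only [boundary, Pi.single_apply, Finset.sum_ite_eq', mem_incidenceFinset,
    mk'_mem_incidenceSet_iff, h, true_and]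
  by_cases h₁ : w = a <;> by_cases h₂ : w = b <;> simp_all

theorem sum_boundary (x : Sym2 V → ZMod 2) : ∑ w, G.boundary x w = 0 := by
  have h : ∀ w, G.boundary x w = ∑ e ∈ G.edgeFinset, if w ∈ e then x e else 0 := by
    intro w
    rw [boundary, ← Finset.sum_filter]
    refine Finset.sum_congr ?_ fun _ _ => rfl
    ext e; simp [incidenceSet]
  simp_rw [h]
  rw [Finset.sum_comm]
  refine Finset.sum_eq_zero fun e he => ?_
  induction e with | _ a b =>
  have hab : a ≠ b := by
    have : G.Adj a b := by simpa using he
    exact this.ne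
  rw [← Finset.sum_filter, Finset.sum_const]
  have : (Finset.univ.filter fun w => w ∈ s(a, b)) = {a, b} := by ext; simp
  rw [this, Finset.card_pair hab, two_nsmul, CharTwo.add_self_eq_zero]

theorem exists_third (hdeg : ∀ v, G.degree v = 3) {w : V} {a b : Sym2 V}
    (ha : a ∈ G.incidenceSet w) (hb : b ∈ G.incidenceSet w) (hab : a ≠ b) :
    ∃ c, c ≠ a ∧ c ≠ b ∧ c ∈ G.incidenceSet w ∧
      ∀ x, G.boundary x w = x a + x b + x c := by
  have h₁ : (G.incidenceFinset w \ {a, b}).card = 1 := by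
    rw [Finset.card_sdiff_of_subset, card_incidenceFinset_eq_degree, hdeg, Finset.card_pair hab]
    intro e; simp; rintro (rfl | rfl) <;> assumption
  obtain ⟨c, hc⟩ := Finset.card_eq_one.1 h₁
  have hc' : ∀ e, e ∈ G.incidenceSet w ∧ ¬(e = a ∨ e = b) ↔ e = c := by
    intro e
    have := Finset.ext_iff.1 hc e
    simpa using this
  have hcc := (hc' c).2 rfl
  have h₂ : G.incidenceFinset w = {a, b, c} := by
    ext e; have := hc' e; simp; grind
  refine ⟨c, by tauto, by tauto, hcc.1, fun x => ?_⟩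
  rw [boundary, h₂, Finset.sum_insert (by grind), Finset.sum_pair (by grind), add_assoc]

theorem exists_boundary_eq_of_walk {S : Set V} {a b : ↥Sᶜ} (p : (G.induce Sᶜ).Walk a b) :
    ∃ x : Sym2 V → ZMod 2, (∀ e, x e ≠ 0 → e ∈ G.edgeSet ∧ ∀ s ∈ S, s ∉ e) ∧
      ∀ w, G.boundary x w = (if w = a then 1 else 0) + (if w = b then 1 else 0) := by
  induction p with
  | nil => exact ⟨0, by simp, fun w => by rw [CharTwo.add_self_eq_zero]; simp [boundary]⟩
  | @cons a v b h p ih =>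
    obtain ⟨x, hx, hbx⟩ := ih
    have h' : G.Adj a v := h
    refine ⟨Pi.single s((a : V), (v : V)) 1 + x, fun e he => ?_, fun w => ?_⟩
    · by_cases hxe : x e = 0
      · have hev : e = s((a : V), (v : V)) := by
          by_contra hne
          simp [hxe, hne] at he
        subst hev
        refine ⟨h', fun s hs hse => ?_⟩
        rcases Sym2.mem_iff.1 hse with rfl | rfl
        · exact a.2 hs
        · exact v.2 hs
      · exact hx e hxe
    · rw [boundary_add, boundary_single h', hbx]
      generalize (if w = (a : V) then (1 : ZMod 2) else 0) = p
      generalize (if w = (v : V) then (1 : ZMod 2) else 0) = q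
      generalize (if w = (b : V) then (1 : ZMod 2) else 0) = r
      revert p q r; decide

theorem exists_isCycleVector_separating (hdeg : ∀ v, G.degree v = 3)
    (h3conn : ∀ S : Set V, S.ncard ≤ 2 → (G.induce Sᶜ).Connected)
    {e f : Sym2 V} (he : e ∈ G.edgeSet) (hf : f ∈ G.edgeSet) (hef : e ≠ f) :
    ∃ x, G.IsCycleVector x ∧ x e = 1 ∧ x f = 0 := by
  obtain ⟨a, b, rfl, hbf⟩ : ∃ a b, e = s(a, b) ∧ b ∉ f := by
    induction e with | _ a b =>
    have hab : a ≠ b := G.ne_of_adj he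
    by_cases hb : b ∈ f
    · refine ⟨b, a, Sym2.eq_swap, fun ha => hef ?_⟩
      exact ((Sym2.mem_and_mem_iff hab).1 ⟨ha, hb⟩).symm
    · exact ⟨a, b, rfl, hb⟩
  obtain ⟨c, d, rfl, hca⟩ : ∃ c d, f = s(c, d) ∧ c ≠ a := by
    induction f with | _ c d =>
    have hcd : c ≠ d := G.ne_of_adj hf
    by_cases hc : c = a
    · exact ⟨d, c, Sym2.eq_swap, by grind⟩
    · exact ⟨c, d, rfl, hc⟩
  have hab : G.Adj a b := he
  obtain ⟨v, hv, hvbc⟩ : ∃ v ∈ G.neighborFinset a, v ∉ ({b, c} : Finset V) := by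
    apply Finset.exists_mem_notMem_of_card_lt_card
    rw [card_neighborFinset_eq_degree, hdeg]
    exact Finset.card_le_two.trans_lt (by norm_num)
  have hav : G.Adj a v := by simpa using hv
  have hbc : b ≠ c := by grind
  have hbS : b ∈ ({a, c} : Set V)ᶜ := by simp [hbc, hab.ne']
  have hvS : v ∈ ({a, c} : Set V)ᶜ := by simp at hvbc; simp [hvbc, hav.ne']
  obtain ⟨p⟩ := (h3conn {a, c} ((Set.ncard_pair hca.symm).le)).preconnected ⟨b, hbS⟩ ⟨v, hvS⟩
  obtain ⟨x, hx, hbx⟩ := exists_boundary_eq_of_walk p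
  have hxa : ∀ u, x s(a, u) = 0 := fun u => by
    by_contra h; exact (hx _ h).2 a (by simp) (by simp)
  have hxc : ∀ u, x s(c, u) = 0 := fun u => by
    by_contra h; exact (hx _ h).2 c (by simp) (by simp)
  refine ⟨x + Pi.single s(a, b) 1 + Pi.single s(a, v) 1, ⟨fun e he => ?_, fun w => ?_⟩, ?_, ?_⟩
  · have h₁ : x e = 0 := by by_contra h; exact he (hx _ h).1
    have h₂ : e ≠ s(a, b) := by rintro rfl; exact he hab
    have h₃ : e ≠ s(a, v) := by rintro rfl; exact he hav
    simp [h₁, h₂, h₃]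
  · rw [boundary_add, boundary_add, boundary_single hab, boundary_single hav, hbx]
    generalize (if w = a then (1 : ZMod 2) else 0) = p
    generalize (if w = b then (1 : ZMod 2) else 0) = q
    generalize (if w = v then (1 : ZMod 2) else 0) = r
    revert p q r; decide
  · have : s(a, b) ≠ s(a, v) := by simp at hvbc ⊢; grind
    simp [hxa, this]
  · have h₁ : s(c, d) ≠ s(a, v) := by simp at hvbc ⊢; grind
    simp [hxc, h₁, hef.symm]

namespace IsDoubleCover

variable {ι : Type*} {C : ι → Sym2 V → ZMod 2}

theorem mem_edgeSet (hC : G.IsDoubleCover C) {i : ι} {e : Sym2 V} (h : C i e = 1) :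
    e ∈ G.edgeSet := by
  by_contra he
  rw [(hC.cyc i).supp e he] at h
  exact zero_ne_one h

theorem exists_eq_one_eq_one (hC : G.IsDoubleCover C) (hdeg : ∀ v, G.degree v = 3) {w : V}
    {a b : Sym2 V} (ha : a ∈ G.incidenceSet w) (hb : b ∈ G.incidenceSet w) :
    ∃ i, C i a = 1 ∧ C i b = 1 := by
  by_cases hab : a = b
  · obtain ⟨i, j, -, h⟩ := hC.cov a ha.1
    exact ⟨i, (h i).2 (Or.inl rfl), hab ▸ (h i).2 (Or.inl rfl)⟩
  obtain ⟨c, -, -, hc, hsum⟩ := exists_third hdeg ha hb hab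
  have hloc : ∀ k, C k a + C k b + C k c = 0 := fun k => by
    rw [← hsum, (hC.cyc k).boundary_eq_zero]
  obtain ⟨i, j, hij, hcov⟩ := hC.cov a ha.1
  obtain ⟨i', j', hij', hcov'⟩ := hC.cov c hc.1
  obtain ⟨k, _, -, hk⟩ := hC.cov b hb.1
  replace hk := (hk k).2 (Or.inl rfl)
  by_contra! hne
  have key : ∀ k, C k a = 1 → C k c = 1 := fun k h => by
    have h₁ := hne k h
    have h₂ := hloc k
    revert h₁ h₂; rw [h]
    generalize C k b = p
    generalize C k c = q
    revert p q; decide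
  have h₁ := (hcov' i).1 (key i ((hcov i).2 (Or.inl rfl)))
  have h₂ := (hcov' j).1 (key j ((hcov j).2 (Or.inr rfl)))
  have h₃ : C k a ≠ 1 := fun h => hne k h hk
  have h₄ : C k c = 1 := by
    have h₂ := hloc k
    revert h₃ h₂; rw [hk]
    generalize C k a = p
    generalize C k c = q
    revert p q; decide
  have h₅ := (hcov' k).1 h₄
  have h₆ := hcov k
  grind

theorem exists_common_edge (hC : G.IsDoubleCover C) (hdeg : ∀ v, G.degree v = 3) {w : V}
    {a b : Sym2 V} (ha : a ∈ G.incidenceSet w) (hb : b ∈ G.incidenceSet w) {i j : ι}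
    (hi : C i a = 1) (hj : C j b = 1) : ∃ e, C i e = 1 ∧ C j e = 1 := by
  by_cases hab : a = b
  · exact ⟨a, hi, hab ▸ hj⟩
  obtain ⟨c, -, -, hc, hsum⟩ := exists_third hdeg ha hb hab
  have h₁ : C i a + C i b + C i c = 0 := by rw [← hsum, (hC.cyc i).boundary_eq_zero]
  have h₂ : C j a + C j b + C j c = 0 := by rw [← hsum, (hC.cyc j).boundary_eq_zero]
  by_contra! hne
  have h₃ := hne a
  have h₄ := hne b
  have h₅ := hne c
  rw [hi] at h₁ h₃
  rw [hj] at h₂ h₄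
  revert h₁ h₂ h₃ h₄ h₅
  generalize C i b = p
  generalize C i c = q
  generalize C j a = r
  generalize C j c = s
  revert p q r s; decide

theorem sum_mul_eq [Fintype ι] (hC : G.IsDoubleCover C) {i j : ι} (hij : i ≠ j) {e : Sym2 V}
    (hi : C i e = 1) (hj : C j e = 1) (y : ι → ZMod 2) : ∑ k, y k * C k e = y i + y j := by
  classical
  obtain ⟨i', j', hij', hcov⟩ := hC.cov e (hC.mem_edgeSet hi)
  have h : ∀ k, C k e = 1 ↔ k = i ∨ k = j := by
    have h₁ := (hcov i).1 hi
    have h₂ := (hcov j).1 hj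
    intro k; rw [hcov]; grind
  have h₀ : ∀ k, y k * C k e = if k ∈ ({i, j} : Finset ι) then y k else 0 := fun k => by
    have := h k
    split_ifs with hk
    · rw [this.2 (by simpa using hk), mul_one]
    · rw [(ZMod.two_eq_zero_or_one (C k e)).resolve_right
        fun h' => hk (by simpa using this.1 h'), mul_zero]
  simp_rw [h₀]
  rw [Finset.sum_ite_mem, Finset.univ_inter, Finset.sum_pair hij]

theorem eq_of_sum_mul_eq_zero [Fintype ι] (hC : G.IsDoubleCover C) {i j : ι} {e : Sym2 V}
    (hi : C i e = 1) (hj : C j e = 1) {y : ι → ZMod 2} (h : ∑ k, y k * C k e = 0) :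
    y i = y j := by
  by_cases hij : i = j
  · rw [hij]
  · rw [hC.sum_mul_eq hij hi hj] at h
    exact CharTwo.add_eq_zero.1 h

theorem exists_eq_one (hC : G.IsDoubleCover C) (i : ι) : ∃ e, C i e = 1 := by
  obtain ⟨e, he⟩ := Function.ne_iff.1 (hC.ne_zero i)
  exact ⟨e, (ZMod.two_eq_zero_or_one _).resolve_left he⟩

theorem exists_eq_const_of_sum_eq_zero [Fintype ι] (hC : G.IsDoubleCover C)
    (hconn : G.Connected) (hdeg : ∀ v, G.degree v = 3) {y : ι → ZMod 2}
    (h : ∀ e ∈ G.edgeSet, ∑ k, y k * C k e = 0) : ∃ t, y = fun _ => t := by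
  obtain hι | ⟨⟨i₀⟩⟩ := isEmpty_or_nonempty ι
  · exact ⟨0, funext fun i => (hι.false i).elim⟩
  have hmem : ∀ i, ∃ w, ∃ a ∈ G.incidenceSet w, C i a = 1 := fun i => by
    obtain ⟨e, he⟩ := hC.exists_eq_one i
    induction e with | _ a b =>
    exact ⟨a, s(a, b), ⟨hC.mem_edgeSet he, by simp⟩, he⟩
  have hloc : ∀ w, ∀ a ∈ G.incidenceSet w, ∀ b ∈ G.incidenceSet w, ∀ i j, C i a = 1 → C j b = 1 →
      y i = y j := fun w a ha b hb i j hi hj => by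
    obtain ⟨e, hie, hje⟩ := hC.exists_common_edge hdeg ha hb hi hj
    exact hC.eq_of_sum_mul_eq_zero hie hje (h e (hC.mem_edgeSet hie))
  obtain ⟨w₀, a₀, ha₀, hi₀⟩ := hmem i₀
  have key : ∀ w, ∀ a ∈ G.incidenceSet w, ∀ i, C i a = 1 → y i = y i₀ := fun w => by
    induction (reachable_iff_reflTransGen _ _).1 (hconn.preconnected w₀ w) with
    | refl => exact fun a ha i hi => hloc w₀ a ha a₀ ha₀ i i₀ hi hi₀
    | @tail u v _ huv ih =>
      intro a ha i hi
      obtain ⟨k, _, -, hk⟩ := hC.cov s(u, v) huv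
      replace hk := (hk k).2 (Or.inl rfl)
      rw [← ih s(u, v) ⟨huv, by simp⟩ k hk]
      exact hloc v a ha s(u, v) ⟨huv, by simp⟩ i k hi hk
  refine ⟨y i₀, funext fun i => ?_⟩
  obtain ⟨w, a, ha, hi⟩ := hmem i
  exact key w a ha i hi

/-- A double cover by `m - n + 2` circuits spans the cycle space. -/
theorem exists_eq_sum [Fintype ι] (hC : G.IsDoubleCover C)
    (hconn : G.Connected) (hdeg : ∀ v, G.degree v = 3)
    (hι : Fintype.card ι + Fintype.card V = G.edgeSet.ncard + 2)
    {x : Sym2 V → ZMod 2} (hx : G.IsCycleVector x) :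
    ∃ y : ι → ZMod 2, ∀ e, x e = ∑ k, y k * C k e := by
  let M : Matrix V G.edgeSet (ZMod 2) := fun w e => if w ∈ e.1 then 1 else 0
  let A : Matrix G.edgeSet ι (ZMod 2) := fun e i => C i e.1
  have hM : ∀ (z : Sym2 V → ZMod 2) w, M.mulVec (fun e => z e.1) w = G.boundary z w := by
    intro z w
    have : G.boundary z w = ∑ e ∈ G.edgeFinset, if w ∈ e then z e else 0 := by
      rw [boundary, ← Finset.sum_filter]
      refine Finset.sum_congr ?_ fun _ _ => rfl
      ext e; simp [incidenceSet]
    rw [this, ← Finset.sum_coe_sort]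
    simp only [Matrix.mulVec, dotProduct, M, ite_mul, one_mul, zero_mul]
    exact Fintype.sum_equiv (Equiv.subtypeEquivRight (by simp)) _ _ fun _ => rfl
  have hA : Fintype.card ι ≤ A.rank + 1 := by
    refine A.card_le_rank_add_one fun y hy => hC.exists_eq_const_of_sum_eq_zero hconn hdeg ?_
    intro e he
    have := congrFun hy ⟨e, he⟩
    simpa [Matrix.mulVec, dotProduct, A, mul_comm] using this
  have hMr : Fintype.card V ≤ M.rank + 1 := by
    rw [← Matrix.rank_transpose]
    refine M.transpose.card_le_rank_add_one fun y hy => ?_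
    obtain ⟨v₀⟩ := hconn.nonempty
    refine ⟨y v₀, funext fun w => ?_⟩
    induction (reachable_iff_reflTransGen _ _).1 (hconn.preconnected v₀ w) with
    | refl => rfl
    | @tail u v _ huv ih =>
      rw [← ih]
      have : ∑ w, (if w ∈ s(u, v) then 1 else 0) * y w = 0 := congrFun hy ⟨s(u, v), huv⟩
      have h' : (Finset.univ.filter fun w => w = u ∨ w = v) = {u, v} := by ext; simp
      simp only [ite_mul, one_mul, zero_mul, Sym2.mem_iff, ← Finset.sum_filter, h',
        Finset.sum_pair huv.ne] at this
      exact (CharTwo.add_eq_zero.1 this).symm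
  have hle : LinearMap.range A.mulVecLin ≤ LinearMap.ker M.mulVecLin := by
    rintro _ ⟨y, rfl⟩
    rw [LinearMap.mem_ker, Matrix.mulVecLin_apply, Matrix.mulVecLin_apply, Matrix.mulVec_mulVec]
    have : M * A = 0 := by
      ext w i
      have := hM (C i) w
      rwa [(hC.cyc i).boundary_eq_zero] at this
    rw [this, Matrix.zero_mulVec]
  have hdim := LinearMap.finrank_range_add_finrank_ker M.mulVecLin
  rw [Module.finrank_fintype_fun_eq_card, ← Nat.card_eq_fintype_card, Nat.card_coe_set_eq] at hdim
  have heq := Submodule.eq_of_le_of_finrank_le hle (by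
    change _ ≤ A.rank
    change M.rank + _ = _ at hdim
    omega)
  have hxM : (fun e : G.edgeSet => x e.1) ∈ LinearMap.ker M.mulVecLin := by
    rw [LinearMap.mem_ker, Matrix.mulVecLin_apply]
    ext w
    rw [hM, hx.boundary_eq_zero]; rfl
  rw [← heq] at hxM
  obtain ⟨y, hy⟩ := hxM
  refine ⟨y, fun e => ?_⟩
  by_cases he : e ∈ G.edgeSet
  · have : ∑ k, C k e * y k = x e := congrFun hy ⟨e, he⟩
    simp_rw [← this, mul_comm]
  · rw [hx.supp e he]
    simp [fun k => (hC.cyc k).supp e he]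

theorem eq_of_common_edges [Fintype ι] (hC : G.IsDoubleCover C)
    (h3conn : ∀ S : Set V, S.ncard ≤ 2 → (G.induce Sᶜ).Connected)
    (hconn : G.Connected) (hdeg : ∀ v, G.degree v = 3)
    (hι : Fintype.card ι + Fintype.card V = G.edgeSet.ncard + 2)
    {i j : ι} (hij : i ≠ j) {e f : Sym2 V} (hie : C i e = 1) (hje : C j e = 1)
    (hif : C i f = 1) (hjf : C j f = 1) : e = f := by
  by_contra hef
  obtain ⟨x, hx, hxe, hxf⟩ := exists_isCycleVector_separating hdeg h3conn
    (hC.mem_edgeSet hie) (hC.mem_edgeSet hif) hef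
  obtain ⟨y, hy⟩ := hC.exists_eq_sum hconn hdeg hι hx
  have h₁ := hy e
  have h₂ := hy f
  rw [hC.sum_mul_eq hij hie hje] at h₁
  rw [hC.sum_mul_eq hij hif hjf] at h₂
  rw [hxe] at h₁
  rw [hxf, ← h₁] at h₂
  exact zero_ne_one h₂

theorem exists_incidence_eq_zero (hC : G.IsDoubleCover C) (hdeg : ∀ v, G.degree v = 3)
    (i : ι) (w : V) : ∃ a ∈ G.incidenceSet w, C i a = 0 := by
  obtain ⟨a, ha, b, hb, hab⟩ := Finset.one_lt_card.1
    (show 1 < (G.incidenceFinset w).card by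
      rw [card_incidenceFinset_eq_degree, hdeg]; norm_num)
  rw [mem_incidenceFinset] at ha hb
  obtain ⟨c, -, -, hc, hsum⟩ := exists_third hdeg ha hb hab
  have h := hsum (C i)
  rw [(hC.cyc i).boundary_eq_zero] at h
  by_contra! hne
  have h₁ := hne a ha
  have h₂ := hne b hb
  have h₃ := hne c hc
  revert h h₁ h₂ h₃
  generalize C i a = p
  generalize C i b = q
  generalize C i c = r
  revert p q r; decide

/-- An edge labelling that is constant around each vertex off a face has the same value at both
ends of each edge of that face. -/
theorem label_eq_of_adj (hC : G.IsDoubleCover C) (hdeg : ∀ v, G.degree v = 3)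
    (hshare : ∀ i j, i ≠ j → ∀ e f, C i e = 1 → C j e = 1 → C i f = 1 → C j f = 1 → e = f)
    {j : ι} {L : Sym2 V → ZMod 2}
    (hL : ∀ w, ∀ a ∈ G.incidenceSet w, ∀ b ∈ G.incidenceSet w, C j a = 0 → C j b = 0 →
      L a = L b) {u v : V} (huv : G.Adj u v) {a b : Sym2 V} (ha : a ∈ G.incidenceSet u)
    (hb : b ∈ G.incidenceSet v) (hja : C j a = 0) (hjb : C j b = 0) : L a = L b := by
  have hu : s(u, v) ∈ G.incidenceSet u := ⟨huv, by simp⟩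
  have hv : s(u, v) ∈ G.incidenceSet v := ⟨huv, by simp⟩
  rcases ZMod.two_eq_zero_or_one (C j s(u, v)) with hje | hje
  · rw [hL u a ha _ hu hja hje, hL v b hb _ hv hjb hje]
  obtain ⟨k, hkj, hke⟩ : ∃ k, k ≠ j ∧ C k s(u, v) = 1 := by
    obtain ⟨p, q, hpq, h⟩ := hC.cov s(u, v) huv
    by_cases hp : p = j
    · exact ⟨q, by grind, (h q).2 (Or.inr rfl)⟩
    · exact ⟨p, hp, (h p).2 (Or.inl rfl)⟩
  have hk : ∀ f, f ≠ s(u, v) → C j f = 1 → C k f = 0 := fun f hf hjf =>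
    (ZMod.two_eq_zero_or_one _).resolve_right fun h => hf (hshare j k hkj.symm _ _ hjf h hje hke)
  let y : Sym2 V → ZMod 2 := fun e => if C j e = 0 then C k e * L e else 0
  have hy_end : ∀ w, s(u, v) ∈ G.incidenceSet w → ∀ f ∈ G.incidenceSet w, C j f = 0 →
      G.boundary y w = L f := by
    intro w hw f hf hjf
    have hne : s(u, v) ≠ f := by rintro rfl; exact zero_ne_one (hjf.symm.trans hje)
    obtain ⟨g, hge, hgf, hg, hsum⟩ := exists_third hdeg hw hf hne
    have hjg : C j g = 1 := by
      have h := hsum (C j)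
      rw [(hC.cyc j).boundary_eq_zero, hje, hjf] at h
      revert h; generalize C j g = p; revert p; decide
    have hkf : C k f = 1 := by
      have h := hsum (C k)
      rw [(hC.cyc k).boundary_eq_zero, hke, hk g hge hjg] at h
      revert h; generalize C k f = p; revert p; decide
    rw [hsum]
    simp [y, hje, hjf, hjg, hkf]
  have hy_off : ∀ w, s(u, v) ∉ G.incidenceSet w → G.boundary y w = 0 := by
    intro w hw
    obtain ⟨f, hf, hjf⟩ := hC.exists_incidence_eq_zero hdeg j w
    have h : ∀ g ∈ G.incidenceFinset w, y g = C k g * L f := by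
      intro g hg
      rw [mem_incidenceFinset] at hg
      rcases ZMod.two_eq_zero_or_one (C j g) with hjg | hjg
      · simp [y, hjg, hL w g hg f hf hjg hjf]
      · have : C k g = 0 := hk g (by rintro rfl; exact hw hg) hjg
        simp [y, hjg, this]
    rw [boundary, Finset.sum_congr rfl h, ← Finset.sum_mul]
    have := (hC.cyc k).boundary_eq_zero w
    rw [boundary] at this
    rw [this, zero_mul]
  have hsum := sum_boundary (G := G) y
  rw [Finset.sum_eq_add u v huv.ne (fun w _ hw => hy_off w (by
      rintro ⟨-, h⟩
      rcases Sym2.mem_iff.1 h with h | h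
      · exact hw.1 h
      · exact hw.2 h)) (by simp) (by simp),
    hy_end u hu a ha hja, hy_end v hv b hb hjb] at hsum
  exact CharTwo.add_eq_zero.1 hsum

theorem exists_label_eq_const (hC : G.IsDoubleCover C) (hconn : G.Connected)
    (hdeg : ∀ v, G.degree v = 3)
    (hshare : ∀ i j, i ≠ j → ∀ e f, C i e = 1 → C j e = 1 → C i f = 1 → C j f = 1 → e = f)
    {j : ι} {L : Sym2 V → ZMod 2}
    (hL : ∀ w, ∀ a ∈ G.incidenceSet w, ∀ b ∈ G.incidenceSet w, C j a = 0 → C j b = 0 →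
      L a = L b) : ∃ t, ∀ e ∈ G.edgeSet, C j e = 0 → L e = t := by
  obtain ⟨v₀⟩ := hconn.nonempty
  obtain ⟨a₀, ha₀, hja₀⟩ := hC.exists_incidence_eq_zero hdeg j v₀
  have key : ∀ w, ∀ a ∈ G.incidenceSet w, C j a = 0 → L a = L a₀ := fun w => by
    induction (reachable_iff_reflTransGen _ _).1 (hconn.preconnected v₀ w) with
    | refl => exact fun a ha hja => hL v₀ a ha a₀ ha₀ hja hja₀
    | @tail u v _ huv ih =>
      intro a ha hja
      obtain ⟨b, hb, hjb⟩ := hC.exists_incidence_eq_zero hdeg j u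
      rw [← ih b hb hjb]
      exact (hC.label_eq_of_adj hdeg hshare hL huv hb ha hjb hja).symm
  refine ⟨L a₀, fun e he hje => ?_⟩
  induction e with | _ a b =>
  exact key a _ ⟨he, by simp⟩ hje

theorem exists_eq {κ : Type*} [Fintype ι] [Fintype κ] {D : κ → Sym2 V → ZMod 2}
    (hC : G.IsDoubleCover C) (hD : G.IsDoubleCover D)
    (h3conn : ∀ S : Set V, S.ncard ≤ 2 → (G.induce Sᶜ).Connected)
    (hconn : G.Connected) (hdeg : ∀ v, G.degree v = 3)
    (hι : Fintype.card ι + Fintype.card V = G.edgeSet.ncard + 2)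
    (hκ : Fintype.card κ + Fintype.card V = G.edgeSet.ncard + 2) (j : κ) :
    ∃ i, C i = D j := by
  classical
  obtain ⟨y, hy⟩ := hC.exists_eq_sum hconn hdeg hι (hD.cyc j)
  let L : Sym2 V → ZMod 2 := fun e => if h : ∃ i, C i e = 1 then y h.choose else 0
  have hLy : ∀ e, D j e = 0 → ∀ i, C i e = 1 → L e = y i := fun e he i hi => by
    have h : ∃ i, C i e = 1 := ⟨i, hi⟩
    simp only [L, dif_pos h]
    exact hC.eq_of_sum_mul_eq_zero h.choose_spec hi ((hy e).symm.trans he)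
  obtain ⟨t, ht⟩ := hD.exists_label_eq_const (j := j) (L := L) hconn hdeg
    (fun i k hik e f h₁ h₂ h₃ h₄ => hD.eq_of_common_edges h3conn hconn hdeg hκ hik h₁ h₂ h₃ h₄)
    (fun w a ha b hb hja hjb => by
      obtain ⟨i, hia, hib⟩ := hC.exists_eq_one_eq_one hdeg ha hb
      rw [hLy a hja i hia, hLy b hjb i hib])
  obtain ⟨i, hi⟩ : ∃ i, y i ≠ t := by
    by_contra! h
    obtain ⟨e, he⟩ := hD.exists_eq_one j
    obtain ⟨p, q, hpq, hcov⟩ := hC.cov e (hD.mem_edgeSet he)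
    rw [hy, hC.sum_mul_eq hpq ((hcov p).2 (Or.inl rfl)) ((hcov q).2 (Or.inr rfl)), h, h,
      CharTwo.add_self_eq_zero] at he
    exact zero_ne_one he
  refine ⟨i, hD.minimal j _ (hC.cyc i) (fun e he => ?_) (hC.ne_zero i)⟩
  refine (ZMod.two_eq_zero_or_one _).resolve_right fun hie => hi ?_
  rw [← hLy e he i hie, ht e (hC.mem_edgeSet hie) he]

end IsDoubleCover

theorem Walk.IsCircuit.isCycleVector_edgeVector {u : V} {p : G.Walk u u} (hp : p.IsCircuit) :
    G.IsCycleVector p.edgeVector where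
  supp e he := if_neg fun h => he (p.edges_subset_edgeSet h)
  boundary_eq_zero w := by
    have h := (hp.isTrail.even_countP_edges_iff w).2 fun h => (h rfl).elim
    rw [List.countP_eq_length_filter,
      ← List.toFinset_card_of_nodup (hp.isTrail.edges_nodup.filter _)] at h
    have h' : (p.edges.filter fun e => decide (w ∈ e)).toFinset =
        (G.incidenceFinset w).filter fun e => e ∈ p.edges := by
      ext e
      have := @Walk.edges_subset_edgeSet _ _ _ _ p e
      simp [incidenceSet]; tauto
    rw [boundary]
    simp only [edgeVector]
    rw [Finset.sum_boole, ← h']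
    exact (ZMod.natCast_eq_zero_iff_even).2 h

theorem Walk.IsCircuit.eq_edgeVector (hdeg : ∀ v, G.degree v = 3) {u : V} {p : G.Walk u u}
    (hp : p.IsCircuit) {x : Sym2 V → ZMod 2} (hx : G.IsCycleVector x)
    (hxp : ∀ e, p.edgeVector e = 0 → x e = 0) (hx₀ : x ≠ 0) : x = p.edgeVector := by
  have hcyc := hp.isCycleVector_edgeVector
  have hloc : ∀ w, ∀ a ∈ G.incidenceSet w, ∀ b ∈ G.incidenceSet w, p.edgeVector a = 1 →
      p.edgeVector b = 1 → x a = x b := by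
    intro w a ha b hb hFa hFb
    by_cases hab : a = b
    · rw [hab]
    obtain ⟨c, -, -, -, hsum⟩ := exists_third hdeg ha hb hab
    have hFc := hsum p.edgeVector
    rw [hcyc.boundary_eq_zero, hFa, hFb, CharTwo.add_self_eq_zero, zero_add] at hFc
    have h := hsum x
    rw [hx.boundary_eq_zero, hxp c hFc.symm, add_zero] at h
    exact CharTwo.add_eq_zero.1 h.symm
  obtain ⟨e₀, he₀u, he₀⟩ : ∃ e₀ ∈ G.incidenceSet u, e₀ ∈ p.edges := by
    cases p with
    | nil => exact absurd rfl hp.ne_nil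
    | @cons _ b _ h q => exact ⟨s(u, b), ⟨h, by simp⟩, by simp⟩
  have hall : ∀ e ∈ p.edges, x e = x e₀ := fun e he =>
    p.apply_eq_of_mem_edges hloc (fun _ => edgeVector_eq_one_iff.2) he₀u
      (edgeVector_eq_one_iff.2 he₀) he
  obtain ⟨f, hf⟩ := Function.ne_iff.1 hx₀
  have hfp : f ∈ p.edges := by
    by_contra h
    exact hf (hxp f (if_neg h))
  have h₁ : x e₀ = 1 := by
    rw [← hall f hfp]; exact (ZMod.two_eq_zero_or_one _).resolve_left hf
  ext e
  by_cases he : e ∈ p.edges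
  · rw [hall e he, h₁, edgeVector_eq_one_iff.2 he]
  · have : p.edgeVector e = 0 := if_neg he
    rw [this, hxp e this]

theorem isDoubleCover_edgeVector (hdeg : ∀ v, G.degree v = 3) {ι : Type*} {u : ι → V}
    {c : ∀ i, G.Walk (u i) (u i)} (hc : ∀ i, (c i).IsCircuit)
    (hcov : ∀ e ∈ G.edgeSet, {i | e ∈ (c i).edges}.ncard = 2) :
    G.IsDoubleCover fun i => (c i).edgeVector where
  cyc i := (hc i).isCycleVector_edgeVector
  ne_zero i h := by
    have hne : (c i).edges ≠ [] := fun h' => (hc i).ne_nil (by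
      rwa [Walk.eq_nil_iff_nil, ← Walk.edges_eq_nil])
    obtain ⟨e, he⟩ := List.exists_mem_of_ne_nil _ hne
    have := Walk.edgeVector_eq_one_iff.2 he
    rw [h] at this
    exact zero_ne_one this
  cov e he := by
    obtain ⟨i, j, hij, h⟩ := Set.ncard_eq_two.1 (hcov e he)
    refine ⟨i, j, hij, fun k => ?_⟩
    rw [Walk.edgeVector_eq_one_iff]
    exact Set.ext_iff.1 h k
  minimal i _ := (hc i).eq_edgeVector hdeg

end SimpleGraph

/-- A 3-connected trivalent simple graph (at least 4 vertices, and the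
induced subgraph on the complement of any set of at most two vertices is connected)
of genus `g = m - n + 1` admits at most one double cover by `g + 1` circuits:
any two families of circuits, each indexed by a finite type of cardinality `g + 1`
(stated as `|ι| + n = m + 2`) in which every edge occurs in exactly two members,
determine the same collection of edge sets. -/
theorem double_cover_unique_of_threeConnected
    {V : Type*} [Fintype V] (G : SimpleGraph V) [DecidableRel G.Adj]
    (hcard : 4 ≤ Fintype.card V)
    (h3conn : ∀ S : Set V, S.ncard ≤ 2 → (G.induce Sᶜ).Connected)
    (hdeg : ∀ v : V, G.degree v = 3)
    {ι κ : Type*} [Fintype ι] [Fintype κ]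
    (u : ι → V) (c : ∀ i : ι, G.Walk (u i) (u i))
    (hc : ∀ i : ι, (c i).IsCircuit)
    (w : κ → V) (d : ∀ j : κ, G.Walk (w j) (w j))
    (hd : ∀ j : κ, (d j).IsCircuit)
    (hι : Fintype.card ι + Fintype.card V = G.edgeSet.ncard + 2)
    (hκ : Fintype.card κ + Fintype.card V = G.edgeSet.ncard + 2)
    (hcovc : ∀ e ∈ G.edgeSet, {i : ι | e ∈ (c i).edges}.ncard = 2)
    (hcovd : ∀ e ∈ G.edgeSet, {j : κ | e ∈ (d j).edges}.ncard = 2) :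
    (Set.range fun i : ι => {e : Sym2 V | e ∈ (c i).edges}) =
      (Set.range fun j : κ => {e : Sym2 V | e ∈ (d j).edges}) := by
  classical
  have hconn : G.Connected := by
    have h := h3conn ∅ (by simp)
    rw [Set.compl_empty] at h
    exact G.induceUnivIso.connected_iff.1 h
  have hC := SimpleGraph.isDoubleCover_edgeVector hdeg hc hcovc
  have hD := SimpleGraph.isDoubleCover_edgeVector hdeg hd hcovd
  have hedges : ∀ {a b : V} {p : G.Walk a a} {q : G.Walk b b}, p.edgeVector = q.edgeVector →
      {e | e ∈ p.edges} = {e | e ∈ q.edges} := fun h => by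
    ext e
    rw [Set.mem_ofPred_eq, Set.mem_ofPred_eq, ← SimpleGraph.Walk.edgeVector_eq_one_iff, h,
      SimpleGraph.Walk.edgeVector_eq_one_iff]
  refine Set.Subset.antisymm ?_ ?_
  · rintro _ ⟨i, rfl⟩
    obtain ⟨j, h⟩ := hD.exists_eq hC h3conn hconn hdeg hκ hι i
    exact ⟨j, hedges h⟩
  · rintro _ ⟨j, rfl⟩
    obtain ⟨i, h⟩ := hC.exists_eq hD h3conn hconn hdeg hι hκ j
    exact ⟨i, hedges h⟩
end

section
/- Let G be a finite simple graph in which every vertex has degree 3, and let (c_i)_{i∈ι} be a family of simple cycles of G, indexed by a finite type ι, such that for every edge e of G the number of indices i for which e occurs among the edges of c_i equals 2. Then for every vertex v of G and every pair of distinct edges e, e' of G both incident to v, there is exactly one index i ∈ ι such that both e and e' occur among the edges of c_i. -/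
/-- A cycle through the edge `va` at a vertex `v` with exactly three neighbors `a`, `b`, `d` uses
exactly one of the two other edges at `v`. -/
theorem SimpleGraph.Walk.IsCycle.mk_mem_edges_iff_of_neighborSet_eq {V : Type*} {G : SimpleGraph V}
    {u v a b d : V} {p : G.Walk u u} (hp : p.IsCycle) (hN : G.neighborSet v = {a, b, d})
    (hab : a ≠ b) (had : a ≠ d) (hbd : b ≠ d) (ha : s(v, a) ∈ p.edges) :
    s(v, b) ∈ p.edges ↔ s(v, d) ∉ p.edges := by
  have hmem (x : V) : x ∈ p.toSubgraph.neighborSet v ↔ s(v, x) ∈ p.edges := by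
    rw [SimpleGraph.Subgraph.mem_neighborSet, ← SimpleGraph.Subgraph.mem_edgeSet,
      SimpleGraph.Walk.mem_edges_toSubgraph]
  have hsub (x : V) (hx : s(v, x) ∈ p.edges) : x = a ∨ x = b ∨ x = d := by
    have hxN : x ∈ G.neighborSet v := p.adj_of_mem_edges hx
    simpa [hN] using hxN
  obtain ⟨x, y, hxy, hset⟩ := Set.ncard_eq_two.mp
    (hp.ncard_neighborSet_toSubgraph_eq_two (p.fst_mem_support_of_mem_edges ha))
  have hiff (z : V) : s(v, z) ∈ p.edges ↔ z = x ∨ z = y := by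
    rw [← hmem, hset, Set.mem_insert_iff, Set.mem_singleton_iff]
  have hx := hsub x ((hiff x).mpr (Or.inl rfl))
  have hy := hsub y ((hiff y).mpr (Or.inr rfl))
  rw [hiff] at ha ⊢
  rw [hiff]
  grind

/-- If three finite sets have two elements each and every element of one of them lies in exactly
one of the two others, then any two of them meet in exactly one element. -/
theorem Set.existsUnique_mem_and_mem_of_ncard_eq_two {ι : Type*} [Finite ι] {A B D : Set ι}
    (hA : A.ncard = 2) (hB : B.ncard = 2) (hD : D.ncard = 2)
    (hAx : ∀ i ∈ A, (i ∈ B ↔ i ∉ D)) (hBx : ∀ i ∈ B, (i ∈ A ↔ i ∉ D))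
    (hDx : ∀ i ∈ D, (i ∈ A ↔ i ∉ B)) : ∃! i, i ∈ A ∧ i ∈ B := by
  have hAB : A \ B = A ∩ D := by grind
  have hBA : B \ A = B ∩ D := by grind
  have hDA : D \ A = B ∩ D := by grind
  have h₁ := Set.ncard_inter_add_ncard_sdiff_eq_ncard A B
  have h₂ := Set.ncard_inter_add_ncard_sdiff_eq_ncard B A
  have h₃ := Set.ncard_inter_add_ncard_sdiff_eq_ncard D A
  rw [hAB] at h₁
  rw [hBA, Set.inter_comm B A] at h₂
  rw [hDA, Set.inter_comm D A] at h₃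
  obtain ⟨i, hi⟩ := Set.ncard_eq_one.mp (show (A ∩ B).ncard = 1 by omega)
  exact ⟨i, hi.ge rfl, fun j hj => hi.le hj⟩

/-- If `G` is a finite trivalent simple graph and `(c i)` is a family of
simple cycles, indexed by a finite type `ι`, in which every edge of `G` occurs in exactly
two members, then for every vertex `v` and every pair of distinct edges `e ≠ e'` of `G`
both incident to `v`, there is exactly one index `i` such that both `e` and `e'` occur
among the edges of `c i`. -/
theorem cycle_double_cover_unique_through_edge_pair
    {V : Type*} [Fintype V] (G : SimpleGraph V) [DecidableRel G.Adj]
    (hdeg : ∀ v : V, G.degree v = 3)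
    {ι : Type*} [Fintype ι]
    (u : ι → V) (c : ∀ i : ι, G.Walk (u i) (u i))
    (hcyc : ∀ i : ι, (c i).IsCycle)
    (hcover : ∀ e ∈ G.edgeSet, {i : ι | e ∈ (c i).edges}.ncard = 2) :
    ∀ v : V, ∀ e e' : Sym2 V, e ∈ G.edgeSet → e' ∈ G.edgeSet → e ≠ e' →
      v ∈ e → v ∈ e' →
      ∃! i : ι, e ∈ (c i).edges ∧ e' ∈ (c i).edges := by
  classical
  intro v e e' he he' hne hv hv'
  obtain ⟨a, rfl⟩ := Sym2.mem_iff_exists.mp hv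
  obtain ⟨b, rfl⟩ := Sym2.mem_iff_exists.mp hv'
  have hab : a ≠ b := by rintro rfl; exact hne rfl
  have hsub : {a, b} ⊆ G.neighborFinset v := by
    simpa [Finset.insert_subset_iff] using And.intro he he'
  obtain ⟨d, hd⟩ : ∃ d, G.neighborFinset v \ {a, b} = {d} := by
    rw [← Finset.card_eq_one, Finset.card_sdiff_of_subset hsub, G.card_neighborFinset_eq_degree,
      hdeg, Finset.card_pair hab]
  have hdm : d ∈ G.neighborFinset v \ {a, b} := by simp [hd]
  have hN : G.neighborSet v = {a, b, d} := by
    rw [← G.coe_neighborFinset, ← Finset.union_sdiff_of_subset hsub, hd]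
    ext x
    simp
  simp only [Finset.mem_sdiff, SimpleGraph.mem_neighborFinset, Finset.mem_insert,
    Finset.mem_singleton, not_or] at hdm
  obtain ⟨hvd, hda, hdb⟩ := hdm
  have hN' : G.neighborSet v = {b, a, d} := hN.trans (Set.insert_comm a b {d})
  have hN'' : G.neighborSet v = {d, a, b} := by rw [hN]; grind
  exact Set.existsUnique_mem_and_mem_of_ncard_eq_two (hcover _ he) (hcover _ he') (hcover _ hvd)
    (fun i hi => (hcyc i).mk_mem_edges_iff_of_neighborSet_eq hN hab (Ne.symm hda) (Ne.symm hdb) hi)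
    (fun i hi => (hcyc i).mk_mem_edges_iff_of_neighborSet_eq hN' hab.symm (Ne.symm hdb)
      (Ne.symm hda) hi)
    (fun i hi => (hcyc i).mk_mem_edges_iff_of_neighborSet_eq hN'' hda hdb hab hi)
end

section
/- Let G be a finite simple graph in which every vertex has degree 3, and let (c_i)_{i∈ι} be a family of simple cycles of G, indexed by a finite type ι, such that for every edge e of G the number of indices i for which e occurs among the edges of c_i equals 2. Let D ⊆ ι be a subset such that for every edge e of G the number of indices i ∈ D with e occurring among the edges of c_i is even. Then for every vertex v of G, either every index i ∈ ι with v in the support of c_i belongs to D, or no index i with v in the support of c_i belongs to D. -/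
/-- A set meeting a two-element set in an even number of elements contains both of these
elements as soon as it contains one of them. -/
theorem mem_of_ncard_eq_two_of_even {ι : Type*} {S D : Set ι} (hS : S.ncard = 2)
    (hD : Even ({i : ι | i ∈ D ∧ i ∈ S}.ncard)) {i j : ι} (hi : i ∈ S) (hj : j ∈ S)
    (hiD : i ∈ D) : j ∈ D := by
  have hfin : S.Finite := Set.finite_of_ncard_ne_zero (by omega)
  have hsub : {k : ι | k ∈ D ∧ k ∈ S} ⊆ S := fun k hk => hk.2
  have hpos : 0 < {k : ι | k ∈ D ∧ k ∈ S}.ncard :=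
    (Set.ncard_pos (hfin.subset hsub)).2 ⟨i, hiD, hi⟩
  obtain ⟨m, hm⟩ := hD
  have heq := Set.eq_of_subset_of_ncard_le hsub (by omega) hfin
  exact (heq.symm.subset hj).1

/-- Two cycles through a common vertex of degree at most `3` share an edge at that vertex. -/
theorem SimpleGraph.Walk.IsCycle.exists_common_edge {V : Type*} {G : SimpleGraph V} {v a b : V}
    [Fintype (G.neighborSet v)] (hdeg : G.degree v ≤ 3) {p : G.Walk a a} {q : G.Walk b b}
    (hp : p.IsCycle) (hq : q.IsCycle) (hvp : v ∈ p.support) (hvq : v ∈ q.support) :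
    ∃ w, s(v, w) ∈ p.edges ∧ s(v, w) ∈ q.edges := by
  have hp2 := hp.ncard_neighborSet_toSubgraph_eq_two hvp
  have hq2 := hq.ncard_neighborSet_toSubgraph_eq_two hvq
  have hN : (G.neighborSet v).ncard ≤ 3 := by
    rwa [← Nat.card_coe_set_eq, Nat.card_eq_fintype_card, G.card_neighborSet_eq_degree]
  have hfin : (G.neighborSet v).Finite := Set.toFinite _
  have hpN := p.toSubgraph.neighborSet_subset v
  have hqN := q.toSubgraph.neighborSet_subset v
  have hinter : (p.toSubgraph.neighborSet v ∩ q.toSubgraph.neighborSet v).Nonempty := by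
    by_contra h
    have hdisj := Set.disjoint_iff_inter_eq_empty.2 (Set.not_nonempty_iff_eq_empty.1 h)
    have hunion := Set.ncard_union_eq hdisj (hfin.subset hpN) (hfin.subset hqN)
    have hle := Set.ncard_le_ncard (Set.union_subset hpN hqN) hfin
    omega
  obtain ⟨w, hwp, hwq⟩ := hinter
  exact ⟨w, p.mem_edges_toSubgraph.1 hwp, q.mem_edges_toSubgraph.1 hwq⟩

/-- Let `G` be a finite trivalent simple graph and `(c i)` a family of
simple cycles, indexed by a finite type `ι`, in which every edge of `G` occurs in exactly
two members. If `D ⊆ ι` is such that every edge of `G` occurs in an even number of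
members indexed by `D`, then for every vertex `v` either all indices whose cycle passes
through `v` belong to `D`, or none of them do. -/
theorem cycle_double_cover_even_subfamily_dichotomy
    {V : Type*} [Fintype V] (G : SimpleGraph V) [DecidableRel G.Adj]
    (hdeg : ∀ v : V, G.degree v = 3)
    {ι : Type*} [Fintype ι]
    (u : ι → V) (c : ∀ i : ι, G.Walk (u i) (u i))
    (hcyc : ∀ i : ι, (c i).IsCycle)
    (hcover : ∀ e ∈ G.edgeSet, {i : ι | e ∈ (c i).edges}.ncard = 2)
    (D : Set ι)
    (hD : ∀ e ∈ G.edgeSet, Even ({i : ι | i ∈ D ∧ e ∈ (c i).edges}.ncard)) :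
    ∀ v : V,
      (∀ i : ι, v ∈ (c i).support → i ∈ D) ∨
      (∀ i : ι, v ∈ (c i).support → i ∉ D) := by
  intro v
  by_cases h : ∃ i, v ∈ (c i).support ∧ i ∈ D
  · obtain ⟨i, hiv, hiD⟩ := h
    refine Or.inl fun j hjv => ?_
    obtain ⟨w, hwi, hwj⟩ := (hcyc i).exists_common_edge (hdeg v).le (hcyc j) hiv hjv
    have he := (c i).edges_subset_edgeSet hwi
    exact mem_of_ncard_eq_two_of_even (hcover _ he) (hD _ he) hwi hwj hiD
  · exact Or.inr fun i hiv hiD => h ⟨i, hiv, hiD⟩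
end

section
/- Let G be a finite connected simple graph in which every vertex has degree 3, and let (c_i)_{i∈ι} be a family of simple cycles of G, indexed by a finite type ι, such that for every edge e of G the number of indices i for which e occurs among the edges of c_i equals 2. If D ⊆ ι is nonempty and for every edge e of G the number of indices i ∈ D with e occurring among the edges of c_i is even, then D = ι. -/
/-- Two cycles through a common vertex of degree at most `3` share an edge at that vertex. -/
theorem SimpleGraph.Walk.IsCycle.exists_mem_edges_of_degree_le_three
    {V : Type*} [Fintype V] {G : SimpleGraph V} [DecidableRel G.Adj] {v a b : V}
    (hdeg : G.degree v ≤ 3) {p : G.Walk a a} {q : G.Walk b b} (hp : p.IsCycle) (hq : q.IsCycle)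
    (hvp : v ∈ p.support) (hvq : v ∈ q.support) :
    ∃ w, s(v, w) ∈ p.edges ∧ s(v, w) ∈ q.edges := by
  by_contra! h
  have hdisj : Disjoint (p.toSubgraph.neighborSet v) (q.toSubgraph.neighborSet v) := by
    rw [Set.disjoint_left]
    intro w hwp hwq
    exact h w (p.adj_toSubgraph_iff_mem_edges.mp hwp) (q.adj_toSubgraph_iff_mem_edges.mp hwq)
  have hsub : p.toSubgraph.neighborSet v ∪ q.toSubgraph.neighborSet v ⊆ G.neighborSet v :=
    Set.union_subset (p.toSubgraph.neighborSet_subset v) (q.toSubgraph.neighborSet_subset v)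
  have hcard := Set.ncard_le_ncard hsub (Set.toFinite _)
  rw [Set.ncard_union_eq hdisj (Set.toFinite _) (Set.toFinite _),
    hp.ncard_neighborSet_toSubgraph_eq_two hvp, hq.ncard_neighborSet_toSubgraph_eq_two hvq,
    Set.ncard_eq_toFinset_card'] at hcard
  change 2 + 2 ≤ G.degree v at hcard
  omega

/-- A subset of a two-element set meeting it in an even number of points is all or nothing. -/
theorem Set.mem_of_even_ncard_of_ncard_eq_two {α : Type*} {D S : Set α} (hS : S.ncard = 2)
    (hD : Even {i | i ∈ D ∧ i ∈ S}.ncard) {i j : α} (hi : i ∈ D) (hiS : i ∈ S) (hjS : j ∈ S) :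
    j ∈ D := by
  by_contra hj
  have hfin : S.Finite := Set.finite_of_ncard_pos (by omega)
  have hlt : {i | i ∈ D ∧ i ∈ S}.ncard < S.ncard :=
    Set.ncard_lt_ncard ⟨fun _ hx => hx.2, fun h => hj (h hjS).1⟩ hfin
  have hpos : 0 < {i | i ∈ D ∧ i ∈ S}.ncard :=
    (Set.ncard_pos (hfin.subset fun _ hx => hx.2)).mpr ⟨i, hi, hiS⟩
  obtain ⟨k, hk⟩ := hD
  omega


/-- Let `G` be a finite connected trivalent simple graph and `(c i)` a
family of simple cycles, indexed by a finite type `ι`, in which every edge of `G` occurs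
in exactly two members. If `D ⊆ ι` is nonempty and every edge of `G` occurs in an even
number of members indexed by `D`, then `D` is all of `ι`. -/
theorem cycle_double_cover_even_subfamily_eq_univ
    {V : Type*} [Fintype V] (G : SimpleGraph V) [DecidableRel G.Adj]
    (hconn : G.Connected) (hdeg : ∀ v : V, G.degree v = 3)
    {ι : Type*} [Fintype ι]
    (u : ι → V) (c : ∀ i : ι, G.Walk (u i) (u i))
    (hcyc : ∀ i : ι, (c i).IsCycle)
    (hcover : ∀ e ∈ G.edgeSet, {i : ι | e ∈ (c i).edges}.ncard = 2)
    (D : Set ι) (hne : D.Nonempty)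
    (hD : ∀ e ∈ G.edgeSet, Even ({i : ι | i ∈ D ∧ e ∈ (c i).edges}.ncard)) :
    D = Set.univ := by
  have hshare : ∀ {v i j}, i ∈ D → v ∈ (c i).support → v ∈ (c j).support → j ∈ D := by
    intro v i j hi hvi hvj
    obtain ⟨w, hwi, hwj⟩ :=
      (hcyc i).exists_mem_edges_of_degree_le_three (hdeg v).le (hcyc j) hvi hvj
    have he := (c i).edges_subset_edgeSet hwi
    exact Set.mem_of_even_ncard_of_ncard_eq_two (hcover _ he) (hD _ he) hi hwi hwj
  have hwalk : ∀ {v w : V}, G.Walk v w → (∃ i ∈ D, v ∈ (c i).support) →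
      ∃ i ∈ D, w ∈ (c i).support := by
    intro v w p
    induction p with
    | nil => exact id
    | cons h _ ih =>
      rintro ⟨i, hi, hvi⟩
      obtain ⟨j, hj⟩ := Set.nonempty_of_ncard_ne_zero
        (by rw [hcover _ (G.mem_edgeSet.mpr h)]; exact two_ne_zero)
      exact ih ⟨j, hshare hi hvi ((c j).fst_mem_support_of_mem_edges hj),
        (c j).snd_mem_support_of_mem_edges hj⟩
  obtain ⟨i₀, hi₀⟩ := hne
  refine Set.eq_univ_of_forall fun j => ?_
  obtain ⟨p⟩ := hconn.preconnected (u i₀) (u j)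
  obtain ⟨i, hi, hij⟩ := hwalk p ⟨i₀, hi₀, (c i₀).start_mem_support⟩
  exact hshare hi hij (c j).start_mem_support
end

section
/- Let G be a finite connected simple graph in which every vertex has degree 3, and let (c_i)_{i∈ι} be a family of simple cycles of G, indexed by a finite type ι, such that for every edge e of G the number of indices i for which e occurs among the edges of c_i equals 2. For each i ∈ ι let χ_i be the indicator function of the edge set of c_i, regarded as an element of the 𝔽₂-vector space of functions from the edge set of G to ZMod 2 (χ_i(e) = 1 if e occurs among the edges of c_i, and 0 otherwise). Then for every proper subset D ⊊ ι, the family (χ_i)_{i∈D} is linearly independent over 𝔽₂ = ZMod 2. -/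
/-- In a graph of maximum degree three, two cycles through a common vertex share an edge. -/
theorem SimpleGraph.Walk.IsCycle.exists_mem_edges_of_mem_support_of_degree_le_three
    {V : Type*} {G : SimpleGraph V} {u u' v : V} [Fintype (G.neighborSet v)]
    {p : G.Walk u u} {q : G.Walk u' u'} (hp : p.IsCycle) (hq : q.IsCycle)
    (hdeg : G.degree v ≤ 3) (hvp : v ∈ p.support) (hvq : v ∈ q.support) :
    ∃ e ∈ p.edges, e ∈ q.edges := by
  have hp2 := hp.ncard_neighborSet_toSubgraph_eq_two hvp
  have hq2 := hq.ncard_neighborSet_toSubgraph_eq_two hvq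
  have hfin : (G.neighborSet v).Finite := Set.toFinite _
  have hpfin := hfin.subset (p.toSubgraph.neighborSet_subset v)
  have hqfin := hfin.subset (q.toSubgraph.neighborSet_subset v)
  have hunion := Set.ncard_le_ncard (Set.union_subset (p.toSubgraph.neighborSet_subset v)
    (q.toSubgraph.neighborSet_subset v)) hfin
  have hcard : (G.neighborSet v).ncard = G.degree v := by
    rw [Set.ncard_eq_toFinset_card', ← SimpleGraph.neighborFinset_def,
      SimpleGraph.card_neighborFinset_eq_degree]
  have hnd : ¬ Disjoint (p.toSubgraph.neighborSet v) (q.toSubgraph.neighborSet v) := fun hd => by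
    have := Set.ncard_union_eq hd hpfin hqfin
    omega
  obtain ⟨w, hwp, hwq⟩ := Set.not_disjoint_iff.mp hnd
  exact ⟨s(v, w), SimpleGraph.Walk.adj_toSubgraph_iff_mem_edges.mp hwp,
    SimpleGraph.Walk.adj_toSubgraph_iff_mem_edges.mp hwq⟩

/-- In a connected graph of maximum degree three, a function on a family of cycles covering all
edges is constant as soon as it takes the same value on any two cycles sharing an edge. -/
theorem SimpleGraph.Connected.eq_of_forall_common_edge_of_degree_le_three
    {V : Type*} {G : SimpleGraph V} [G.LocallyFinite] {ι α : Type*}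
    (hconn : G.Connected) (hdeg : ∀ v, G.degree v ≤ 3)
    {u : ι → V} {c : ∀ i, G.Walk (u i) (u i)} (hcyc : ∀ i, (c i).IsCycle)
    (hcover : ∀ e ∈ G.edgeSet, ∃ i, e ∈ (c i).edges) {f : ι → α}
    (hf : ∀ i j, ∀ e ∈ (c i).edges, e ∈ (c j).edges → f i = f j) (i j : ι) : f i = f j := by
  have local_eq : ∀ v i j, v ∈ (c i).support → v ∈ (c j).support → f i = f j := by
    intro v i j hi hj
    obtain ⟨e, hei, hej⟩ :=
      (hcyc i).exists_mem_edges_of_mem_support_of_degree_le_three (hcyc j) (hdeg v) hi hj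
    exact hf i j e hei hej
  have along_walk : ∀ {v w : V}, G.Walk v w → ∀ i j, v ∈ (c i).support →
      w ∈ (c j).support → f i = f j := by
    intro v w p
    induction p with
    | nil => exact local_eq _
    | cons h _ ih =>
      intro i j hi hj
      obtain ⟨k, hk⟩ := hcover _ (G.mem_edgeSet.mpr h)
      exact (local_eq _ i k hi ((c k).fst_mem_support_of_mem_edges hk)).trans
        (ih k j ((c k).snd_mem_support_of_mem_edges hk) hj)
  obtain ⟨p⟩ := hconn.preconnected (u i) (u j)
  exact along_walk p i j (c i).start_mem_support (c j).start_mem_support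


/-- Let `G` be a finite connected trivalent simple graph and `(c i)` a
family of simple cycles, indexed by a finite type `ι`, in which every edge of `G` occurs
in exactly two members. For each `i` let `χ i : G.edgeSet → ZMod 2` be the indicator
function of the edge set of `c i`. Then for every proper subset `D ⊊ ι`, the family
`(χ i)_{i ∈ D}` is linearly independent over `𝔽₂ = ZMod 2`. -/
theorem cycle_double_cover_proper_subfamily_linearIndependent
    {V : Type*} [Fintype V] [DecidableEq V]
    (G : SimpleGraph V) [DecidableRel G.Adj]
    (hconn : G.Connected) (hdeg : ∀ v : V, G.degree v = 3)
    {ι : Type*} [Fintype ι]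
    (u : ι → V) (c : ∀ i : ι, G.Walk (u i) (u i))
    (hcyc : ∀ i : ι, (c i).IsCycle)
    (hcover : ∀ e ∈ G.edgeSet, {i : ι | e ∈ (c i).edges}.ncard = 2)
    (χ : ι → (G.edgeSet → ZMod 2))
    (hχ : ∀ (i : ι) (e : G.edgeSet),
      χ i e = if (e : Sym2 V) ∈ (c i).edges then 1 else 0) :
    ∀ D : Set ι, D ≠ Set.univ →
      LinearIndependent (ZMod 2) (fun i : D => χ i) := by
  intro D hD
  obtain ⟨i₀, hi₀⟩ := (Set.ne_univ_iff_exists_notMem D).mp hD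
  refine linearIndepOn_iff.mpr fun l hl hsum => Finsupp.ext fun i => ?_
  have hl₀ : l i₀ = 0 := (Finsupp.mem_supported' _ _).mp hl i₀ hi₀
  rw [Finsupp.coe_zero, Pi.zero_apply, ← hl₀]
  refine hconn.eq_of_forall_common_edge_of_degree_le_three (fun v => (hdeg v).le) hcyc
    (fun e he => ?_) (fun i j e hei hej => ?_) i i₀
  · have hne : {i | e ∈ (c i).edges}.ncard ≠ 0 := by simp [hcover e he]
    exact Set.nonempty_of_ncard_ne_zero hne
  · classical
    by_cases hij : i = j
    · rw [hij]
    have he := (c i).edges_subset_edgeSet hei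
    have hset : {k | e ∈ (c k).edges} = {i, j} := by
      refine (Set.eq_of_subset_of_ncard_le ?_ ?_ (Set.toFinite _)).symm
      · rintro k (rfl | rfl) <;> assumption
      · rw [hcover e he, Set.ncard_pair hij]
    have hmem : ∀ k, e ∈ (c k).edges ↔ k = i ∨ k = j := fun k => Set.ext_iff.mp hset k
    have hval := congrFun hsum ⟨e, he⟩
    rw [Finsupp.linearCombination_apply, Finsupp.sum_fintype _ _ (by simp)] at hval
    simp only [Finset.sum_apply, Pi.smul_apply, hχ, hmem, smul_eq_mul, mul_ite, mul_one,
      mul_zero, Pi.zero_apply] at hval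
    have hfilter : ({k | k = i ∨ k = j} : Finset ι) = {i, j} := by ext; simp
    rw [← Finset.sum_filter, hfilter, Finset.sum_pair hij] at hval
    exact CharTwo.add_eq_zero.mp hval
end

section
/- Let S = ℝ[x₁,…,x_N] be a multivariate polynomial ring, let p ∈ ℝ^N, and let I₀ ⊆ S be an ideal such that every element of I₀ vanishes at p (so evaluation at p induces a well-defined map ev : S/I₀ → ℝ). Suppose f, f', h, l₁, l₂, l₁', l₂' ∈ S satisfy: f·l₁·l₂ ∈ I₀, f'·l₁'·l₂' ∈ I₀, h·(l₁ − l₁') ∈ I₀, h·(l₂ − l₂') ∈ I₀, f(p) ≠ 0, f'(p) ≠ 0, h(p) ≠ 0, and l₁(p) = l₂(p) = 0. Let σ : I₀ → S/I₀ be any homomorphism of S-modules, where I₀ is regarded as an S-submodule of S. If ev(σ(f·l₁·l₂)) = 0, then ev(σ(f'·l₁'·l₂')) = 0. -/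
/-- The map on a quotient ring induced by a ring homomorphism is semilinear. -/
theorem Ideal.Quotient.lift_smul_eq_mul {R A : Type*} [CommRing R] [CommRing A]
    (I : Ideal R) (φ : R →+* A) (hI : ∀ q ∈ I, φ q = 0) (s : R) (x : R ⧸ I) :
    Ideal.Quotient.lift I φ hI (s • x) = φ s * Ideal.Quotient.lift I φ hI x := by
  rw [Algebra.smul_def, map_mul, Ideal.Quotient.algebraMap_eq, Ideal.Quotient.lift_mk]

/-- abstract form of Lemma 4.2(2) of the paper. Let
`S = ℝ[x₁,…,x_N]`, let `p ∈ ℝ^N`, and let `I₀ ⊆ S` be an ideal all of whose elements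
vanish at `p`, so that evaluation at `p` induces a map `ev : S/I₀ → ℝ`. Suppose
`f·l₁·l₂ ∈ I₀`, `f'·l₁'·l₂' ∈ I₀`, `h·(l₁ - l₁') ∈ I₀`, `h·(l₂ - l₂') ∈ I₀`,
`f(p) ≠ 0`, `f'(p) ≠ 0`, `h(p) ≠ 0`, `l₁(p) = l₂(p) = 0`. Then for any `S`-module
homomorphism `σ : I₀ → S/I₀`, if `ev (σ (f·l₁·l₂)) = 0` then `ev (σ (f'·l₁'·l₂')) = 0`. -/
theorem hyperplane_condition_well_defined
    {N : ℕ} (p : Fin N → ℝ)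
    (I₀ : Ideal (MvPolynomial (Fin N) ℝ))
    (hI : ∀ q ∈ I₀, MvPolynomial.eval p q = 0)
    (f f' h l₁ l₂ l₁' l₂' : MvPolynomial (Fin N) ℝ)
    (hF : f * l₁ * l₂ ∈ I₀) (hF' : f' * l₁' * l₂' ∈ I₀)
    (hh₁ : h * (l₁ - l₁') ∈ I₀) (hh₂ : h * (l₂ - l₂') ∈ I₀)
    (hf : MvPolynomial.eval p f ≠ 0) (hf' : MvPolynomial.eval p f' ≠ 0)
    (hhp : MvPolynomial.eval p h ≠ 0)
    (hl₁ : MvPolynomial.eval p l₁ = 0) (hl₂ : MvPolynomial.eval p l₂ = 0)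
    (σ : I₀ →ₗ[MvPolynomial (Fin N) ℝ] (MvPolynomial (Fin N) ℝ ⧸ I₀))
    (hσ : Ideal.Quotient.lift I₀ (MvPolynomial.eval p) hI (σ ⟨f * l₁ * l₂, hF⟩) = 0) :
    Ideal.Quotient.lift I₀ (MvPolynomial.eval p) hI (σ ⟨f' * l₁' * l₂', hF'⟩) = 0 := by
  have hl₂' : MvPolynomial.eval p l₂' = 0 := by
    have h0 := hI _ hh₂
    rw [map_mul, map_sub, hl₂, zero_sub] at h0
    exact neg_eq_zero.mp ((mul_eq_zero.mp h0).resolve_left hhp)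
  have key : (f * h) • (⟨f' * l₁' * l₂', hF'⟩ : I₀) =
      (f' * h) • (⟨f * l₁ * l₂, hF⟩ : I₀)
        - (f * f' * l₂') • (⟨h * (l₁ - l₁'), hh₁⟩ : I₀)
        - (f * f' * l₁) • (⟨h * (l₂ - l₂'), hh₂⟩ : I₀) := by
    apply Subtype.ext
    simp only [Submodule.coe_sub, Submodule.coe_smul, smul_eq_mul]
    ring
  have hev := congrArg (fun x => Ideal.Quotient.lift I₀ (MvPolynomial.eval p) hI (σ x)) key
  simp only [map_sub, map_smul, Ideal.Quotient.lift_smul_eq_mul, map_mul, hσ, hl₁, hl₂',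
    mul_zero, zero_mul, sub_zero] at hev
  exact (mul_eq_zero.mp hev).resolve_left (mul_ne_zero hf hhp)
end
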